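/- arXiv:2008.07472 — 2 statements merged into one kernel-verified Lean document; each statement's English description precedes it below -/
import Mathlib

section
/- Let n ≥ 1 and let S be a nonempty bounded subset of ℝⁿ₊. Then there exists a unique vector p* ∈ (ℝⁿ₊)↓ such that s ≺_w p* for all s ∈ S, and such that every p ∈ ℝⁿ₊ satisfying s ≺_w p for all s ∈ S also satisfies p* ≺_w p. -/
open Matrix
open scoped ComplexOrder

/-- Sum of the `k` largest entries of `p` (as a supremum of sums over `k`-subsets). -/
noncomputable def sumLargest {n : ℕ} (p : Fin n → ℝ) (k : ℕ) : ℝ :=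
  sSup ((fun A : Finset (Fin n) => ∑ i ∈ A, p i) '' {A : Finset (Fin n) | A.card = k})

/-- `p` is weakly majorized by `q`. -/
def WeakMaj {n : ℕ} (p q : Fin n → ℝ) : Prop :=
  ∀ k : ℕ, 1 ≤ k → k ≤ n → sumLargest p k ≤ sumLargest q k

/-- `p` is majorized by `q`. -/
def Maj {n : ℕ} (p q : Fin n → ℝ) : Prop :=
  WeakMaj p q ∧ ∑ i, p i = ∑ i, q i

/-- `p` has nonnegative entries arranged in decreasing order. -/
def DecrNonneg {n : ℕ} (p : Fin n → ℝ) : Prop :=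
  Antitone p ∧ ∀ i, 0 ≤ p i

/-- The decreasing rearrangement of a vector. -/
noncomputable def decrRearrange {n : ℕ} (p : Fin n → ℝ) : Fin n → ℝ :=
  fun i => p (Tuple.sort p (Fin.rev i))

/-- `x` is the supremum of `S` in the weak-majorization order (w-sup). -/
def IsWSup {n : ℕ} (S : Set (Fin n → ℝ)) (x : Fin n → ℝ) : Prop :=
  DecrNonneg x ∧ (∀ s ∈ S, WeakMaj s x) ∧
    ∀ p : Fin n → ℝ, (∀ i, 0 ≤ p i) → (∀ s ∈ S, WeakMaj s p) → WeakMaj x p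

/-- `x` is the infimum of `Q` in the weak-majorization order (w-inf). -/
def IsWInf {n : ℕ} (Q : Set (Fin n → ℝ)) (x : Fin n → ℝ) : Prop :=
  DecrNonneg x ∧ (∀ q ∈ Q, WeakMaj x q) ∧
    ∀ p : Fin n → ℝ, (∀ i, 0 ≤ p i) → (∀ q ∈ Q, WeakMaj p q) → WeakMaj p x

open Classical in
/-- The vector of eigenvalues of a Hermitian matrix, in decreasing order
(junk value `0` if the matrix is not Hermitian). -/
noncomputable def specVec {n : ℕ} (X : Matrix (Fin n) (Fin n) ℂ) : Fin n → ℝ :=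
  if h : X.IsHermitian then decrRearrange h.eigenvalues else 0

open Classical in
/-- `λ(|X|)`: the absolute values of the eigenvalues of a Hermitian matrix `X`,
in decreasing order. -/
noncomputable def absSpecVec {n : ℕ} (X : Matrix (Fin n) (Fin n) ℂ) : Fin n → ℝ :=
  if h : X.IsHermitian then decrRearrange (fun i => |h.eigenvalues i|) else 0

/-- The Jordan product `X ∘ Y = (XY + YX)/2`. -/
noncomputable def jmul {n : ℕ} (X Y : Matrix (Fin n) (Fin n) ℂ) : Matrix (Fin n) (Fin n) ℂ :=
  (2 : ℂ)⁻¹ • (X * Y + Y * X)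

/-- A nonzero (orthogonal) projection in `ℋⁿ`. -/
def IsProjection {n : ℕ} (P : Matrix (Fin n) (Fin n) ℂ) : Prop :=
  P.IsHermitian ∧ P * P = P ∧ P ≠ 0

/-- An involution in `ℋⁿ`: a Hermitian matrix with `ε² = I`. -/
def IsInvolution {n : ℕ} (ε : Matrix (Fin n) (Fin n) ℂ) : Prop :=
  ε.IsHermitian ∧ ε * ε = 1

/-- A positive map: maps positive semidefinite matrices to positive semidefinite matrices. -/
def PositiveMap {n : ℕ} (T : Matrix (Fin n) (Fin n) ℂ → Matrix (Fin n) (Fin n) ℂ) : Prop :=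
  ∀ X : Matrix (Fin n) (Fin n) ℂ, X.PosSemidef → (T X).PosSemidef

/-- `S` is the adjoint of `T` with respect to the trace inner product on `ℋⁿ`. -/
def IsAdjointOf {n : ℕ} (S T : Matrix (Fin n) (Fin n) ℂ → Matrix (Fin n) (Fin n) ℂ) : Prop :=
  ∀ X Y : Matrix (Fin n) (Fin n) ℂ, X.IsHermitian → Y.IsHermitian →
    Matrix.trace (T X * Y) = Matrix.trace (X * S Y)

/-- `q` is the least vector of `T`: `λ(|T(X)|) ≺_w q * λ(|X|)` for all Hermitian `X`,
and `q ≺_w q'` for any other `q' ∈ (ℝⁿ₊)↓` with the same property. -/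
def IsLeastVector {n : ℕ} (T : Matrix (Fin n) (Fin n) ℂ → Matrix (Fin n) (Fin n) ℂ)
    (q : Fin n → ℝ) : Prop :=
  DecrNonneg q ∧
  (∀ X : Matrix (Fin n) (Fin n) ℂ, X.IsHermitian →
    WeakMaj (absSpecVec (T X)) (q * absSpecVec X)) ∧
  ∀ q' : Fin n → ℝ, DecrNonneg q' →
    (∀ X : Matrix (Fin n) (Fin n) ℂ, X.IsHermitian →
      WeakMaj (absSpecVec (T X)) (q' * absSpecVec X)) → WeakMaj q q'

theorem sum_le_sumLargest {n : ℕ} (p : Fin n → ℝ) (A : Finset (Fin n)) :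
    ∑ i ∈ A, p i ≤ sumLargest p A.card :=
  le_csSup (Set.toFinite _).bddAbove ⟨A, rfl, rfl⟩

theorem exists_card_eq_sumLargest {n : ℕ} (p : Fin n → ℝ) {k : ℕ} (hk : k ≤ n) :
    ∃ A : Finset (Fin n), A.card = k ∧ ∑ i ∈ A, p i = sumLargest p k := by
  obtain ⟨A, -, hA⟩ := Finset.exists_subset_card_eq
    (s := (Finset.univ : Finset (Fin n))) (n := k) (by simpa using hk)
  have hne : ((fun A : Finset (Fin n) => ∑ i ∈ A, p i) ''
      {A : Finset (Fin n) | A.card = k}).Nonempty := ⟨_, A, hA, rfl⟩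
  exact hne.csSup_mem (Set.toFinite _)

theorem sumLargest_zero {n : ℕ} (p : Fin n → ℝ) : sumLargest p 0 = 0 := by
  simp [sumLargest]

theorem sumLargest_le_succ {n : ℕ} {p : Fin n → ℝ} (hp : ∀ i, 0 ≤ p i) {k : ℕ} (hk : k < n) :
    sumLargest p k ≤ sumLargest p (k + 1) := by
  obtain ⟨A, hA, hAs⟩ := exists_card_eq_sumLargest p hk.le
  obtain ⟨b, hb⟩ : ∃ b, b ∉ A := by
    by_contra! h
    have : A = Finset.univ := Finset.eq_univ_of_forall h
    simp [this] at hA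
    omega
  have h := sum_le_sumLargest p (insert b A)
  rw [Finset.sum_insert hb, Finset.card_insert_of_notMem hb, hA, hAs] at h
  linarith [hp b]

theorem sumLargest_nonneg {n : ℕ} {p : Fin n → ℝ} (hp : ∀ i, 0 ≤ p i) {k : ℕ} (hk : k ≤ n) :
    0 ≤ sumLargest p k := by
  obtain ⟨A, -, hA⟩ := exists_card_eq_sumLargest p hk
  rw [← hA]
  exact Finset.sum_nonneg fun i _ => hp i

/-- The sum of the `k` largest entries is a concave function of `k`. -/
theorem sumLargest_add_le {n : ℕ} (p : Fin n → ℝ) {k : ℕ} (hk : k + 2 ≤ n) :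
    sumLargest p k + sumLargest p (k + 2) ≤ 2 * sumLargest p (k + 1) := by
  obtain ⟨A, hA, hAs⟩ := exists_card_eq_sumLargest p (show k ≤ n by omega)
  obtain ⟨B, hB, hBs⟩ := exists_card_eq_sumLargest p hk
  obtain ⟨b, hbB, hbA⟩ := Finset.exists_mem_notMem_of_card_lt_card (show A.card < B.card by omega)
  have h1 := sum_le_sumLargest p (insert b A)
  have h2 := sum_le_sumLargest p (B.erase b)
  rw [Finset.sum_insert hbA, Finset.card_insert_of_notMem hbA, hA, hAs] at h1
  rw [Finset.card_erase_of_mem hbB, hB] at h2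
  have h3 := Finset.add_sum_erase B p hbB
  simp only [Nat.add_succ_sub_one] at h2
  linarith

theorem sum_filter_val_lt_succ {n : ℕ} (p : Fin n → ℝ) (i : Fin n) :
    ∑ j with j.val < i.val + 1, p j = p i + ∑ j with j.val < i.val, p j := by
  rw [← Finset.sum_insert (by simp)]
  congr 1
  ext j
  simp only [Finset.mem_filter, Finset.mem_univ, true_and, Finset.mem_insert, Fin.ext_iff]
  omega

/-- For a decreasing vector, the `k` largest entries are the first `k` ones. -/
theorem sumLargest_of_antitone {n : ℕ} {p : Fin n → ℝ} (hp : Antitone p) {k : ℕ} (hk : k ≤ n) :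
    sumLargest p k = ∑ j with j.val < k, p j := by
  have hcard : (Finset.univ.filter fun j : Fin n => j.val < k).card = k := by
    rw [Fin.card_filter_val_lt]
    omega
  apply le_antisymm
  · obtain _ | m := k
    · simp [sumLargest_zero]
    obtain ⟨A, hA, hAs⟩ := exists_card_eq_sumLargest p hk
    rw [← hAs]
    set t := p ⟨m, hk⟩
    have h1 : ∑ i ∈ A, (p i - t) ≤ ∑ i with i.val < m + 1, (p i - t) :=
      calc ∑ i ∈ A, (p i - t) ≤ ∑ i ∈ A, if i.val < m + 1 then p i - t else 0 := by
            refine Finset.sum_le_sum fun i _ => ?_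
            split_ifs with h
            · exact le_rfl
            · exact sub_nonpos.2 (hp (Fin.le_def.2 (by simp only; omega)))
        _ ≤ ∑ i, if i.val < m + 1 then p i - t else 0 := by
            refine Finset.sum_le_sum_of_subset_of_nonneg (Finset.subset_univ _) fun i _ _ => ?_
            split_ifs with h
            · exact sub_nonneg.2 (hp (Fin.le_def.2 (by simp only; omega)))
            · exact le_rfl
        _ = _ := (Finset.sum_filter _ _).symm
    rw [Finset.sum_sub_distrib, Finset.sum_sub_distrib, Finset.sum_const, Finset.sum_const,
      hA, hcard] at h1
    linarith
  · simpa only [hcard] using sum_le_sumLargest p (Finset.univ.filter fun j : Fin n => j.val < k)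

theorem WeakMaj.antisymm {n : ℕ} {p q : Fin n → ℝ} (hp : Antitone p) (hq : Antitone q)
    (hpq : WeakMaj p q) (hqp : WeakMaj q p) : p = q := by
  have h : ∀ k ≤ n, sumLargest p k = sumLargest q k := by
    intro k hk
    obtain rfl | hk0 := Nat.eq_zero_or_pos k
    · simp only [sumLargest_zero]
    · exact le_antisymm (hpq k hk0 hk) (hqp k hk0 hk)
  ext i
  have h1 := h (i.val + 1) i.isLt
  have h2 := h i.val i.isLt.le
  rw [sumLargest_of_antitone hp i.isLt, sumLargest_of_antitone hq i.isLt,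
    sum_filter_val_lt_succ, sum_filter_val_lt_succ] at h1
  rw [sumLargest_of_antitone hp i.isLt.le, sumLargest_of_antitone hq i.isLt.le] at h2
  linarith

/-- A concave increasing sequence vanishing at `0` is the sequence of sums of largest entries
of its vector of increments. -/
theorem exists_decrNonneg_sumLargest_eq {n : ℕ} {c : ℕ → ℝ} (h0 : c 0 = 0)
    (hmono : ∀ k < n, c k ≤ c (k + 1))
    (hconc : ∀ k, k + 2 ≤ n → c k + c (k + 2) ≤ 2 * c (k + 1)) :
    ∃ p : Fin n → ℝ, DecrNonneg p ∧ ∀ k ≤ n, sumLargest p k = c k := by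
  have hanti : Antitone fun i : Fin n => c (i.val + 1) - c i.val := by
    have key : ∀ d a : ℕ, a + d < n → c (a + d + 1) - c (a + d) ≤ c (a + 1) - c a := by
      intro d a
      induction d with
      | zero => intro _; exact le_rfl
      | succ d ih =>
        intro h
        have h1 := ih (by omega)
        have h2 := hconc (a + d) (by omega)
        rw [show a + (d + 1) + 1 = a + d + 2 by omega, show a + (d + 1) = a + d + 1 by omega]
        linarith
    intro i j hij
    have hij' : i.val ≤ j.val := hij
    obtain ⟨d, hd⟩ := Nat.exists_eq_add_of_le hij'
    have := key d i.val (by omega)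
    rwa [← hd] at this
  refine ⟨_, ⟨hanti, fun i => sub_nonneg.2 (hmono i i.isLt)⟩, fun k hk => ?_⟩
  rw [sumLargest_of_antitone hanti hk]
  induction k with
  | zero => simp [h0]
  | succ k ih =>
    have h := sum_filter_val_lt_succ (fun i : Fin n => c (i.val + 1) - c i.val) ⟨k, hk⟩
    simp only at h
    rw [h, ih (by omega)]
    ring

theorem weakMaj_of_le {n : ℕ} {p q : Fin n → ℝ} (h : ∀ i, p i ≤ q i) : WeakMaj p q := by
  intro k _ hk
  obtain ⟨A, hA, hAs⟩ := exists_card_eq_sumLargest p hk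
  rw [← hAs, ← hA]
  exact (Finset.sum_le_sum fun i _ => h i).trans (sum_le_sumLargest q A)

theorem weak_majorization_sup_exists (n : ℕ) (hn : 1 ≤ n) (S : Set (Fin n → ℝ))
    (hSne : S.Nonempty) (hSpos : ∀ s ∈ S, ∀ i, 0 ≤ s i)
    (hSbdd : ∃ C : ℝ, ∀ s ∈ S, ∀ i, s i ≤ C) :
    ∃! ps : Fin n → ℝ, DecrNonneg ps ∧ (∀ s ∈ S, WeakMaj s ps) ∧
      ∀ p : Fin n → ℝ, (∀ i, 0 ≤ p i) → (∀ s ∈ S, WeakMaj s p) → WeakMaj ps p := by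
  obtain ⟨C, hC⟩ := hSbdd
  let P : Set (Fin n → ℝ) := {p | (∀ i, 0 ≤ p i) ∧ ∀ s ∈ S, WeakMaj s p}
  have hP : Nonempty P := by
    refine ⟨fun _ => C, fun i => ?_, fun s hs => weakMaj_of_le (hC s hs)⟩
    obtain ⟨s, hs⟩ := hSne
    exact (hSpos s hs i).trans (hC s hs i)
  let c : ℕ → ℝ := fun k => ⨅ p : P, sumLargest p.1 k
  have hle : ∀ k ≤ n, ∀ p : P, c k ≤ sumLargest p.1 k := fun k hk p =>
    ciInf_le ⟨0, by rintro _ ⟨q, rfl⟩; exact sumLargest_nonneg q.2.1 hk⟩ p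
  obtain ⟨ps, hps, hpsc⟩ := exists_decrNonneg_sumLargest_eq (n := n) (c := c)
    (by simp [c, sumLargest_zero])
    (fun k hk => le_ciInf fun p => (hle k hk.le p).trans (sumLargest_le_succ p.2.1 hk))
    (fun k hk => by
      have h : (c k + c (k + 2)) / 2 ≤ c (k + 1) := le_ciInf fun p => by
        linarith [hle k (by omega) p, hle (k + 2) hk p, sumLargest_add_le p.1 hk]
      linarith)
  have hub : ∀ s ∈ S, WeakMaj s ps := by
    intro s hs k hk1 hk
    rw [hpsc k hk]
    exact le_ciInf fun p => p.2.2 s hs k hk1 hk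
  have hleast : ∀ p : Fin n → ℝ, (∀ i, 0 ≤ p i) → (∀ s ∈ S, WeakMaj s p) → WeakMaj ps p := by
    intro p hp hpS k _ hk
    rw [hpsc k hk]
    exact hle k hk ⟨p, hp, hpS⟩
  refine ⟨ps, ⟨hps, hub, hleast⟩, ?_⟩
  rintro q ⟨hq, hqub, hqleast⟩
  exact (hqleast ps hps.2 hub).antisymm hq.1 hps.1 (hleast q hq.2 hqub)
end

section
/- Let T : ℋⁿ → ℋⁿ be an ℝ-linear map and q ∈ (ℝⁿ₊)↓. Then λ(|T(X)|) ≺_w q*λ(|X|) holds for all X ∈ ℋⁿ if and only if λ(|T(P∘ε)|) ≺_w q*λ(P) holds for every nonzero projection P ∈ ℋⁿ and every involution ε ∈ ℋⁿ. -/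
open Matrix
open scoped ComplexOrder

/-- Sum of the entries with index below `k`. -/
def headSum {n : ℕ} (p : Fin n → ℝ) (k : ℕ) : ℝ :=
  ∑ j with j.val < k, p j

/-- The Hermitian matrix with eigenvector matrix `V` and eigenvalues `x`. -/
noncomputable def specMat {n : ℕ} (V : Matrix (Fin n) (Fin n) ℂ) (x : Fin n → ℝ) :
    Matrix (Fin n) (Fin n) ℂ :=
  V * diagonal (fun j => (x j : ℂ)) * Vᴴ

/-- The sum of the first `k` diagonal entries of `Uᴴ A W` (real part). -/
noncomputable def headTrace {n : ℕ} (k : ℕ) (U W A : Matrix (Fin n) (Fin n) ℂ) : ℝ :=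
  headSum (fun j => ((Uᴴ * A * W) j j).re) k

section Vectors

variable {n : ℕ}

lemma headSum_eq_sum_ite (p : Fin n → ℝ) (k : ℕ) :
    headSum p k = ∑ j, if j.val < k then p j else 0 :=
  Finset.sum_filter _ _

lemma headSum_mono {p q : Fin n → ℝ} (h : ∀ j, p j ≤ q j) (k : ℕ) : headSum p k ≤ headSum q k :=
  Finset.sum_le_sum fun j _ => h j

lemma sum_mul_le_headSum {p d : Fin n → ℝ} (hp : Antitone p) (hd0 : ∀ j, 0 ≤ d j)
    (hd1 : ∀ j, d j ≤ 1) {k : ℕ} (hk : 1 ≤ k) (hkn : k ≤ n) (hd : ∑ j, d j = k) :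
    ∑ j, p j * d j ≤ headSum p k := by
  set t := p ⟨k - 1, by omega⟩ with ht
  have hcard : (∑ j : Fin n, if j.val < k then (1 : ℝ) else 0) = k := by
    rw [Finset.sum_boole, Fin.card_filter_val_lt, min_eq_right hkn]
  calc ∑ j, p j * d j
      ≤ ∑ j : Fin n, ((if j.val < k then p j else 0)
          + t * (d j - if j.val < k then 1 else 0)) := by
        refine Finset.sum_le_sum fun j _ => ?_
        split_ifs with hj
        · have : t ≤ p j := hp (Fin.mk_le_mk.2 (by omega) : j ≤ ⟨k - 1, by omega⟩)
          nlinarith [hd1 j]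
        · have : p j ≤ t := hp (Fin.mk_le_mk.2 (by omega) : ⟨k - 1, by omega⟩ ≤ j)
          nlinarith [hd0 j]
    _ = headSum p k := by
        rw [Finset.sum_add_distrib, ← Finset.mul_sum, Finset.sum_sub_distrib, hd, hcard,
          headSum_eq_sum_ite]
        ring

lemma sumLargest_eq_headSum {p : Fin n → ℝ} (hp : Antitone p) {k : ℕ} (hk : 1 ≤ k)
    (hkn : k ≤ n) : sumLargest p k = headSum p k := by
  refine IsGreatest.csSup_eq ⟨⟨Finset.univ.filter fun j => j.val < k, ?_, rfl⟩, ?_⟩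
  · simp [Fin.card_filter_val_lt, hkn]
  · rintro _ ⟨A, hA, rfl⟩
    have := sum_mul_le_headSum hp (d := fun j => if j ∈ A then 1 else 0)
      (fun j => by split_ifs <;> simp) (fun j => by split_ifs <;> simp) hk hkn
      (by simpa using hA)
    simpa using this

/-- A decreasing nonnegative vector is a nonnegative combination of indicators of initial
segments. -/
lemma DecrNonneg.exists_layers {p : Fin n → ℝ} (hp : DecrNonneg p) :
    ∃ c : Fin n → ℝ, (∀ i, 0 ≤ c i) ∧ ∀ j, p j = ∑ i, c i * if j ≤ i then 1 else 0 := by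
  induction n with
  | zero => exact ⟨0, fun i => i.elim0, fun j => j.elim0⟩
  | succ m ih =>
    obtain ⟨c, hc, h⟩ := ih (p := fun j => p j.castSucc - p (Fin.last m))
      ⟨fun a b hab => sub_le_sub_right (hp.1 (Fin.castSucc_le_castSucc_iff.2 hab)) _,
        fun i => sub_nonneg.2 (hp.1 (Fin.le_last _))⟩
    refine ⟨Fin.snoc c (p (Fin.last m)), fun i => ?_, fun j => ?_⟩
    · refine Fin.lastCases ?_ (fun i => ?_) i
      · simpa using hp.2 _
      · simpa using hc i
    · rw [Fin.sum_univ_castSucc]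
      refine Fin.lastCases ?_ (fun j => ?_) j
      · simp [Fin.last_le_iff, (Fin.castSucc_lt_last _).ne]
      · have := h j
        simp only [Fin.snoc_castSucc, Fin.snoc_last, Fin.castSucc_le_castSucc_iff, Fin.le_last,
          if_true, mul_one]
        linarith

lemma DecrNonneg.mul {p q : Fin n → ℝ} (hp : DecrNonneg p) (hq : DecrNonneg q) :
    DecrNonneg (p * q) :=
  ⟨fun _ _ h => mul_le_mul (hp.1 h) (hq.1 h) (hq.2 _) (hp.2 _),
    fun i => mul_nonneg (hp.2 i) (hq.2 i)⟩

lemma headSum_mul_le_headSum_mul {q x y : Fin n → ℝ} (hq : DecrNonneg q)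
    (h : ∀ k, 1 ≤ k → k ≤ n → headSum x k ≤ headSum y k) (k : ℕ) :
    headSum (q * x) k ≤ headSum (q * y) k := by
  obtain ⟨c, hc, hqc⟩ := hq.exists_layers
  have key (z : Fin n → ℝ) : headSum (q * z) k = ∑ i, c i * headSum z (min k (i.val + 1)) := by
    simp only [headSum_eq_sum_ite, Finset.mul_sum, Pi.mul_apply]
    rw [Finset.sum_comm]
    refine Finset.sum_congr rfl fun j _ => ?_
    rw [hqc j]
    by_cases hj : j.val < k
    · rw [if_pos hj, Finset.sum_mul]
      refine Finset.sum_congr rfl fun i _ => ?_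
      by_cases hji : j ≤ i
      · have : j.val < min k (i.val + 1) := lt_min hj (Nat.lt_succ_of_le hji)
        simp [hji, this]
      · have : ¬ j.val < min k (i.val + 1) := fun hlt =>
          hji (Nat.le_of_lt_succ (hlt.trans_le (min_le_right _ _)))
        rw [if_neg hji, if_neg this]
        ring
    · have (i : Fin n) : ¬ j.val < min k (i.val + 1) := fun hlt =>
        hj (hlt.trans_le (min_le_left _ _))
      simp [hj]
  rw [key, key]
  refine Finset.sum_le_sum fun i _ => mul_le_mul_of_nonneg_left ?_ (hc i)
  rcases Nat.eq_zero_or_pos k with rfl | hk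
  · simp [headSum]
  · exact h _ (by omega) (by omega)

lemma decrRearrange_antitone (p : Fin n → ℝ) : Antitone (decrRearrange p) := fun _ _ h =>
  Tuple.monotone_sort p (Fin.rev_le_rev.2 h)

end Vectors

section Spectral

variable {n : ℕ} {A U V W : Matrix (Fin n) (Fin n) ℂ}

lemma specMat_isHermitian (V : Matrix (Fin n) (Fin n) ℂ) (x : Fin n → ℝ) :
    (specMat V x).IsHermitian := by
  simp only [IsHermitian, specMat, conjTranspose_mul, conjTranspose_conjTranspose,
    diagonal_conjTranspose, mul_assoc]
  congr 3
  ext j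
  simp

lemma specMat_mul_specMat (hV : Vᴴ * V = 1) (x y : Fin n → ℝ) :
    specMat V x * specMat V y = specMat V (x * y) := by
  simp only [specMat]
  calc _ = V * diagonal (fun j => (x j : ℂ)) * (Vᴴ * V) * diagonal (fun j => (y j : ℂ)) * Vᴴ := by
        simp only [mul_assoc]
    _ = _ := by
        rw [hV, mul_one, mul_assoc V, diagonal_mul_diagonal]
        simp

lemma specMat_one (hV : Vᴴ * V = 1) : specMat V 1 = 1 := by
  simp [specMat, mul_eq_one_comm.1 hV]

lemma conj_specMat (hV : Vᴴ * V = 1) (x : Fin n → ℝ) :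
    Vᴴ * specMat V x * V = diagonal (fun j => (x j : ℂ)) := by
  calc _ = (Vᴴ * V) * diagonal (fun j => (x j : ℂ)) * (Vᴴ * V) := by
        simp only [specMat, mul_assoc]
    _ = _ := by simp [hV]

lemma specMat_injective (hV : Vᴴ * V = 1) : Function.Injective (specMat V) := by
  intro x y h
  have := conj_specMat hV x
  rw [h, conj_specMat hV] at this
  ext j
  simpa using (congrFun (diagonal_injective this) j).symm

lemma specMat_sum_smul {ι : Type*} (s : Finset ι) (V : Matrix (Fin n) (Fin n) ℂ) (c : ι → ℝ)
    (x : ι → Fin n → ℝ) :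
    specMat V (∑ i ∈ s, c i • x i) = ∑ i ∈ s, c i • specMat V (x i) := by
  let f : (Fin n → ℝ) →ₗ[ℝ] Matrix (Fin n) (Fin n) ℂ :=
    { toFun := specMat V
      map_add' := fun x y => by
        simp only [specMat, Pi.add_apply, Complex.ofReal_add, ← diagonal_add, mul_add, add_mul]
      map_smul' := fun r x => by
        have : diagonal (fun j => ((r • x) j : ℂ)) = r • diagonal (fun j => (x j : ℂ)) := by
          rw [← diagonal_smul]
          congr 1
          ext j
          simp
        simp only [specMat, this, Matrix.mul_smul, Matrix.smul_mul, RingHom.id_apply] }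
  exact (map_sum f _ s).trans (Finset.sum_congr rfl fun i _ => map_smul f _ _)

/-- Spectral decomposition along the rearrangement of the eigenvalues by a given permutation. -/
lemma exists_specMat_perm (hA : A.IsHermitian) (σ : Equiv.Perm (Fin n)) :
    ∃ V : Matrix (Fin n) (Fin n) ℂ, Vᴴ * V = 1 ∧ A = specMat V (hA.eigenvalues ∘ σ) := by
  set E : Matrix (Fin n) (Fin n) ℂ := ↑hA.eigenvectorUnitary with hE
  have hE1 : Eᴴ * E = 1 := mem_unitaryGroup_iff'.1 hA.eigenvectorUnitary.2
  refine ⟨E.submatrix id σ, ?_, ?_⟩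
  · rw [conjTranspose_submatrix, ← submatrix_mul Eᴴ E σ id σ Function.bijective_id, hE1]
    simp
  · have h := hA.spectral_theorem
    rw [Unitary.conjStarAlgAut_apply] at h
    rw [specMat, conjTranspose_submatrix]
    have hd : diagonal (fun j => ((hA.eigenvalues ∘ σ) j : ℂ))
        = (diagonal (RCLike.ofReal ∘ hA.eigenvalues) : Matrix (Fin n) (Fin n) ℂ).submatrix σ σ := by
      rw [submatrix_diagonal_equiv]
      rfl
    rw [hd, submatrix_mul_equiv, submatrix_mul_equiv]
    simpa [star_eq_conjTranspose, hE] using h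

lemma absSpecVec_decrNonneg (hA : A.IsHermitian) : DecrNonneg (absSpecVec A) := by
  rw [absSpecVec, dif_pos hA]
  exact ⟨decrRearrange_antitone _, fun i => abs_nonneg _⟩

lemma exists_specMat_absSpecVec (hA : A.IsHermitian) :
    ∃ (V : Matrix (Fin n) (Fin n) ℂ) (x : Fin n → ℝ), Vᴴ * V = 1 ∧ A = specMat V x ∧
      ∀ j, |x j| = absSpecVec A j := by
  obtain ⟨V, hV, hAV⟩ := exists_specMat_perm hA
    (Fin.revPerm.trans (Tuple.sort fun i => |hA.eigenvalues i|))
  refine ⟨V, _, hV, hAV, fun j => ?_⟩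
  rw [absSpecVec, dif_pos hA]
  rfl

lemma sum_normSq_row (hU : U * Uᴴ = 1) (i : Fin n) : ∑ j, Complex.normSq (U i j) = 1 := by
  have := congrFun (congrFun hU i) i
  simp only [mul_apply, conjTranspose_apply, one_apply_eq, RCLike.star_def, Complex.mul_conj] at this
  exact_mod_cast this

lemma sum_normSq_col (hU : Uᴴ * U = 1) (j : Fin n) : ∑ i, Complex.normSq (U i j) = 1 := by
  have h := sum_normSq_row (U := Uᴴ) (by simpa using hU) j
  simpa [Complex.normSq_conj] using h

lemma unitary_conjTranspose_mul (hU : Uᴴ * U = 1) (hV : Vᴴ * V = 1) :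
    (Uᴴ * V)ᴴ * (Uᴴ * V) = 1 := by
  calc _ = Vᴴ * (U * Uᴴ) * V := by
        simp only [conjTranspose_mul, conjTranspose_conjTranspose, mul_assoc]
    _ = 1 := by rw [mul_eq_one_comm.1 hU, mul_one, hV]

lemma re_mul_mul_le (a b : ℂ) (r : ℝ) :
    (a * r * b).re ≤ |r| * ((Complex.normSq a + Complex.normSq b) / 2) := by
  calc (a * r * b).re ≤ ‖a * r * b‖ := Complex.re_le_norm _
    _ = |r| * (‖a‖ * ‖b‖) := by simp; ring
    _ ≤ _ := by
      rw [Complex.normSq_eq_norm_sq, Complex.normSq_eq_norm_sq]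
      gcongr
      nlinarith [sq_nonneg (‖a‖ - ‖b‖)]

lemma headTrace_specMat_le (hU : Uᴴ * U = 1) (hV : Vᴴ * V = 1) (hW : Wᴴ * W = 1)
    {x : Fin n → ℝ} (hx : Antitone fun j => |x j|) {k : ℕ} (hk : 1 ≤ k) (hkn : k ≤ n) :
    headTrace k U W (specMat V x) ≤ headSum (fun j => |x j|) k := by
  set M := Uᴴ * V with hM
  set N := Vᴴ * W with hN
  have hM1 : Mᴴ * M = 1 := unitary_conjTranspose_mul hU hV
  have hN1 : Nᴴ * N = 1 := unitary_conjTranspose_mul hV hW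
  have hMN : Uᴴ * specMat V x * W = M * diagonal (fun j => (x j : ℂ)) * N := by
    simp only [hM, hN, specMat, mul_assoc]
  let e : Fin n → Fin n → ℝ := fun j l =>
    (Complex.normSq (M j l) + Complex.normSq (N l j)) / 2
  have he (j l) : 0 ≤ e j l := by
    have := Complex.normSq_nonneg (M j l)
    have := Complex.normSq_nonneg (N l j)
    simp only [e]; positivity
  have hrow (j) : ∑ l, e j l = 1 := by
    simp only [e, ← Finset.sum_div, Finset.sum_add_distrib,
      sum_normSq_row (mul_eq_one_comm.1 hM1), sum_normSq_col hN1]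
    norm_num
  have hcol (l) : ∑ j, e j l = 1 := by
    simp only [e, ← Finset.sum_div, Finset.sum_add_distrib,
      sum_normSq_row (mul_eq_one_comm.1 hN1), sum_normSq_col hM1]
    norm_num
  have hentry (j) : ((Uᴴ * specMat V x * W) j j).re ≤ ∑ l, |x l| * e j l := by
    rw [hMN, mul_apply, Complex.re_sum]
    refine Finset.sum_le_sum fun l _ => ?_
    rw [mul_diagonal]
    exact re_mul_mul_le _ _ _
  refine (headSum_mono hentry k).trans ?_
  rw [headSum, Finset.sum_comm]
  simp only [← Finset.mul_sum]
  refine sum_mul_le_headSum hx (fun l => Finset.sum_nonneg fun j _ => he j l) (fun l => ?_)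
    hk hkn ?_
  · rw [← hcol l]
    exact Finset.sum_le_sum_of_subset_of_nonneg (Finset.subset_univ _) fun j _ _ => he j l
  · rw [Finset.sum_comm]
    simp [hrow, Fin.card_filter_val_lt, hkn]

/-- The signs of the entries of a real vector, with `0` counted as positive. -/
noncomputable def signVec (x : Fin n → ℝ) : Fin n → ℝ := fun j => if 0 ≤ x j then 1 else -1

lemma signVec_mul_self (x : Fin n → ℝ) : signVec x * signVec x = 1 := by
  ext j
  simp only [signVec, Pi.mul_apply, Pi.one_apply]
  split_ifs <;> norm_num

lemma signVec_mul (x : Fin n → ℝ) : signVec x * x = fun j => |x j| := by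
  ext j
  simp only [signVec, Pi.mul_apply]
  split_ifs with h
  · rw [one_mul, abs_of_nonneg h]
  · rw [abs_of_neg (not_le.1 h), neg_one_mul]

lemma exists_headTrace_specMat_eq (hV : Vᴴ * V = 1) (x : Fin n → ℝ) (k : ℕ) :
    ∃ U W : Matrix (Fin n) (Fin n) ℂ, Uᴴ * U = 1 ∧ Wᴴ * W = 1 ∧
      headTrace k U W (specMat V x) = headSum (fun j => |x j|) k := by
  have hS := specMat_isHermitian V (signVec x)
  refine ⟨specMat V (signVec x) * V, V, ?_, hV, ?_⟩
  · rw [conjTranspose_mul, hS.eq, mul_assoc, ← mul_assoc (specMat V _), specMat_mul_specMat hV,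
      signVec_mul_self, specMat_one hV, one_mul, hV]
  · rw [headTrace, conjTranspose_mul, hS.eq, mul_assoc Vᴴ, specMat_mul_specMat hV, signVec_mul,
      conj_specMat hV]
    simp

lemma headSum_absSpecVec_specMat (hV : Vᴴ * V = 1) {x : Fin n → ℝ}
    (hx : Antitone fun j => |x j|) {k : ℕ} (hk : 1 ≤ k) (hkn : k ≤ n) :
    headSum (absSpecVec (specMat V x)) k = headSum (fun j => |x j|) k := by
  have hA := specMat_isHermitian V x
  obtain ⟨V', x', hV', hAV', hx'⟩ := exists_specMat_absSpecVec hA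
  have hfun : (fun j => |x' j|) = absSpecVec (specMat V x) := funext hx'
  have hanti : Antitone fun j => |x' j| := hfun ▸ (absSpecVec_decrNonneg hA).1
  rw [← hfun]
  apply le_antisymm
  · obtain ⟨U, W, hU, hW, h⟩ := exists_headTrace_specMat_eq hV' x' k
    rw [← h, ← hAV']
    exact headTrace_specMat_le hU hV hW hx hk hkn
  · obtain ⟨U, W, hU, hW, h⟩ := exists_headTrace_specMat_eq hV x k
    rw [← h, hAV']
    exact headTrace_specMat_le hU hV' hW hanti hk hkn

/-- Ky Fan's maximum principle, upper bound. -/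
lemma headTrace_le (hA : A.IsHermitian) (hU : Uᴴ * U = 1) (hW : Wᴴ * W = 1) {k : ℕ}
    (hk : 1 ≤ k) (hkn : k ≤ n) : headTrace k U W A ≤ headSum (absSpecVec A) k := by
  obtain ⟨V, x, hV, hAV, hx⟩ := exists_specMat_absSpecVec hA
  have hfun : (fun j => |x j|) = absSpecVec A := funext hx
  have h := headTrace_specMat_le hU hV hW (hfun ▸ (absSpecVec_decrNonneg hA).1) hk hkn
  rwa [← hAV, hfun] at h

/-- Ky Fan's maximum principle, attainment. -/
lemma exists_headTrace_eq (hA : A.IsHermitian) (k : ℕ) :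
    ∃ U W : Matrix (Fin n) (Fin n) ℂ, Uᴴ * U = 1 ∧ Wᴴ * W = 1 ∧
      headTrace k U W A = headSum (absSpecVec A) k := by
  obtain ⟨V, x, hV, hAV, hx⟩ := exists_specMat_absSpecVec hA
  obtain ⟨U, W, hU, hW, h⟩ := exists_headTrace_specMat_eq hV x k
  refine ⟨U, W, hU, hW, ?_⟩
  rw [hAV, h, ← hAV, ← funext hx]

lemma headTrace_sum_smul {ι : Type*} (s : Finset ι) (c : ι → ℝ)
    (B : ι → Matrix (Fin n) (Fin n) ℂ) (k : ℕ) (U W : Matrix (Fin n) (Fin n) ℂ) :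
    headTrace k U W (∑ i ∈ s, c i • B i) = ∑ i ∈ s, c i * headTrace k U W (B i) := by
  simp only [headTrace, headSum, Matrix.sum_mul, Finset.mul_sum, Matrix.mul_smul,
    Matrix.smul_mul, Matrix.sum_apply, Complex.re_sum, Matrix.smul_apply, Complex.smul_re,
    smul_eq_mul]
  exact Finset.sum_comm

lemma headSum_absSpecVec_sum_smul_le {ι : Type*} (s : Finset ι) {c : ι → ℝ} (hc : ∀ i, 0 ≤ c i)
    {B : ι → Matrix (Fin n) (Fin n) ℂ} (hB : ∀ i, (B i).IsHermitian)
    (hA : (∑ i ∈ s, c i • B i).IsHermitian) {k : ℕ} (hk : 1 ≤ k) (hkn : k ≤ n) :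
    headSum (absSpecVec (∑ i ∈ s, c i • B i)) k ≤ ∑ i ∈ s, c i * headSum (absSpecVec (B i)) k := by
  obtain ⟨U, W, hU, hW, h⟩ := exists_headTrace_eq hA k
  rw [← h, headTrace_sum_smul]
  exact Finset.sum_le_sum fun i _ =>
    mul_le_mul_of_nonneg_left (headTrace_le (hB i) hU hW hk hkn) (hc i)

lemma jmul_isHermitian {P ε : Matrix (Fin n) (Fin n) ℂ} (hP : P.IsHermitian)
    (hε : ε.IsHermitian) : (jmul P ε).IsHermitian := by
  simp [IsHermitian, jmul, conjTranspose_smul, conjTranspose_mul, hP.eq, hε.eq, add_comm]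

lemma headSum_absSpecVec_jmul_le {P ε : Matrix (Fin n) (Fin n) ℂ} (hP : P.IsHermitian)
    (hε : IsInvolution ε) {k : ℕ} (hk : 1 ≤ k) (hkn : k ≤ n) :
    headSum (absSpecVec (jmul P ε)) k ≤ headSum (absSpecVec P) k := by
  obtain ⟨U, W, hU, hW, h⟩ := exists_headTrace_eq (jmul_isHermitian hP hε.1) k
  have hunit {Z : Matrix (Fin n) (Fin n) ℂ} (hZ : Zᴴ * Z = 1) : (ε * Z)ᴴ * (ε * Z) = 1 := by
    rw [conjTranspose_mul, hε.1.eq, mul_assoc, ← mul_assoc ε, hε.2, one_mul, hZ]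
  have hsplit : headTrace k U W (jmul P ε)
      = (headTrace k U (ε * W) P + headTrace k (ε * U) W P) / 2 := by
    simp only [headTrace, headSum, ← Finset.sum_add_distrib, Finset.sum_div]
    refine Finset.sum_congr rfl fun j _ => ?_
    have : Uᴴ * jmul P ε * W
        = (2 : ℝ)⁻¹ • (Uᴴ * P * (ε * W) + (ε * U)ᴴ * P * W) := by
      simp only [jmul, conjTranspose_mul, hε.1.eq, mul_add, add_mul, mul_assoc, Matrix.mul_smul,
        Matrix.smul_mul]
      ext i j
      simp [Complex.real_smul, mul_add]
    rw [this]
    simp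
    ring
  have h1 := headTrace_le hP hU (hunit hW) hk hkn
  have h2 := headTrace_le hP (hunit hU) hW hk hkn
  rw [← h, hsplit]
  linarith

lemma IsProjection.specVec_eq {P : Matrix (Fin n) (Fin n) ℂ} (hP : IsProjection P) :
    specVec P = absSpecVec P := by
  have hpos : P.PosSemidef := by
    have := posSemidef_conjTranspose_mul_self P
    rwa [hP.1.eq, hP.2.1] at this
  rw [specVec, absSpecVec, dif_pos hP.1, dif_pos hP.1]
  congr 1
  ext i
  exact (abs_of_nonneg (hpos.eigenvalues_nonneg i)).symm

/-- The indicator of the initial segment ending at `i`. -/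
def initVec (i : Fin n) : Fin n → ℝ := fun j => if j ≤ i then 1 else 0

lemma isProjection_specMat_initVec (hV : Vᴴ * V = 1) (i : Fin n) :
    IsProjection (specMat V (initVec i)) := by
  refine ⟨specMat_isHermitian _ _, ?_, fun h => ?_⟩
  · rw [specMat_mul_specMat hV]
    congr 1
    ext j
    simp [initVec]
  · have h0 : specMat V 0 = 0 := by simp [specMat]
    have := congrFun (specMat_injective hV (h.trans h0.symm)) i
    simp [initVec] at this

lemma isInvolution_specMat_signVec (hV : Vᴴ * V = 1) (x : Fin n → ℝ) :
    IsInvolution (specMat V (signVec x)) :=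
  ⟨specMat_isHermitian _ _, by rw [specMat_mul_specMat hV, signVec_mul_self, specMat_one hV]⟩

lemma jmul_specMat (hV : Vᴴ * V = 1) (x y : Fin n → ℝ) :
    jmul (specMat V x) (specMat V y) = specMat V (x * y) := by
  rw [jmul, specMat_mul_specMat hV, specMat_mul_specMat hV, mul_comm y x, ← two_smul ℂ, smul_smul]
  norm_num

end Spectral

theorem weak_majorization_ineq_iff_proj (n : ℕ) (T : Matrix (Fin n) (Fin n) ℂ → Matrix (Fin n) (Fin n) ℂ)
    (hTlin : IsLinearMap ℝ T)
    (hT : ∀ X : Matrix (Fin n) (Fin n) ℂ, X.IsHermitian → (T X).IsHermitian)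
    (q : Fin n → ℝ) (hq : DecrNonneg q) :
    (∀ X : Matrix (Fin n) (Fin n) ℂ, X.IsHermitian →
      WeakMaj (absSpecVec (T X)) (q * absSpecVec X)) ↔
    (∀ P ε : Matrix (Fin n) (Fin n) ℂ, IsProjection P → IsInvolution ε →
      WeakMaj (absSpecVec (T (jmul P ε))) (q * specVec P)) := by
  constructor
  · intro h P ε hP hε k hk hkn
    have hY := jmul_isHermitian hP.1 hε.1
    refine (h _ hY k hk hkn).trans ?_
    rw [hP.specVec_eq, sumLargest_eq_headSum (hq.mul (absSpecVec_decrNonneg hY)).1 hk hkn,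
      sumLargest_eq_headSum (hq.mul (absSpecVec_decrNonneg hP.1)).1 hk hkn]
    exact headSum_mul_le_headSum_mul hq
      (fun k hk hkn => headSum_absSpecVec_jmul_le hP.1 hε hk hkn) k
  · intro h X hX k hk hkn
    obtain ⟨V, x, hV, hXV, hx⟩ := exists_specMat_absSpecVec hX
    obtain ⟨c, hc, hlayer⟩ := (absSpecVec_decrNonneg hX).exists_layers
    have hB (i : Fin n) := isProjection_specMat_initVec hV i
    have hε := isInvolution_specMat_signVec hV x
    have hY (i : Fin n) := hT _ (jmul_isHermitian (hB i).1 hε.1)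
    have hxc : x = ∑ i, c i • (initVec i * signVec x) := by
      have habs : x = (fun j => |x j|) * signVec x := by
        rw [← signVec_mul, mul_right_comm, signVec_mul_self, one_mul]
      ext j
      rw [congrFun habs j, Pi.mul_apply, hx, hlayer j, Finset.sum_apply, Finset.sum_mul]
      exact Finset.sum_congr rfl fun i _ => mul_assoc _ _ _
    have hTX : T X = ∑ i, c i • T (jmul (specMat V (initVec i)) (specMat V (signVec x))) := by
      let f := hTlin.mk' T
      change f X = ∑ i, c i • f _
      simp only [jmul_specMat hV, ← map_smul, ← map_sum]
      rw [← specMat_sum_smul, ← hxc, ← hXV]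
    have hstep (i : Fin n) :
        headSum (absSpecVec (T (jmul (specMat V (initVec i)) (specMat V (signVec x))))) k
          ≤ headSum (q * initVec i) k := by
      have h1 := h _ _ (hB i) hε k hk hkn
      rw [(hB i).specVec_eq, sumLargest_eq_headSum (absSpecVec_decrNonneg (hY i)).1 hk hkn,
        sumLargest_eq_headSum (hq.mul (absSpecVec_decrNonneg (hB i).1)).1 hk hkn] at h1
      refine h1.trans (headSum_mul_le_headSum_mul hq (fun m hm hmn => ?_) k)
      have habs : (fun j => |initVec i j|) = initVec i := by
        ext j
        simp only [initVec]
        split_ifs <;> simp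
      have hanti : Antitone (initVec i) := by
        intro a b hab
        simp only [initVec]
        split_ifs with h1 h2
        · exact le_rfl
        · exact absurd (hab.trans h1) h2
        · exact zero_le_one
        · exact le_rfl
      rw [headSum_absSpecVec_specMat hV (habs.symm ▸ hanti) hm hmn, habs]
    rw [sumLargest_eq_headSum (absSpecVec_decrNonneg (hT X hX)).1 hk hkn,
      sumLargest_eq_headSum (hq.mul (absSpecVec_decrNonneg hX)).1 hk hkn, hTX]
    refine (headSum_absSpecVec_sum_smul_le _ hc hY (hTX ▸ hT X hX) hk hkn).trans ?_
    refine (Finset.sum_le_sum fun i _ => mul_le_mul_of_nonneg_left (hstep i) (hc i)).trans_eq ?_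
    simp only [headSum, Finset.mul_sum, Pi.mul_apply]
    rw [Finset.sum_comm]
    refine Finset.sum_congr rfl fun j _ => ?_
    rw [hlayer j, Finset.mul_sum]
    exact Finset.sum_congr rfl fun i _ => mul_left_comm _ _ _
end
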